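/- 8·( 3·F₃(√−3/6) − F₃(√−3/2) ) − 9·( 3·F₃(√−3/3) − F₃(√−3) ) = 7√3·π³/135 + ζ(3), where √−3 denotes i√3. -/

import Mathlib

open scoped Real

/-- `F₃(τ) = Σ_{m≥1} Σ_{n≥1} e^{2πimnτ}/n³`. -/
noncomputable def F₃ (τ : ℂ) : ℂ :=
  ∑' m : ℕ, ∑' n : ℕ,
    Complex.exp (2 * Real.pi * Complex.I * ((m : ℂ) + 1) * ((n : ℂ) + 1) * τ) / ((n : ℂ) + 1) ^ 3

/-- The general term of the Lambert series of `F₃`, as a function of the nome `q`. -/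
noncomputable def lambertTerm (q : ℂ) (n : ℕ) : ℂ := q ^ n / (1 - q ^ n) / (n : ℂ) ^ 3

lemma norm_cexp_two_pi_I_mul_lt_one {τ : ℂ} (hτ : 0 < τ.im) :
    ‖Complex.exp (2 * π * Complex.I * τ)‖ < 1 :=
  UpperHalfPlane.norm_exp_two_pi_I_lt_one ⟨τ, hτ⟩

lemma summable_pow_mul_div_cube {q : ℂ} (hq : ‖q‖ < 1) :
    Summable fun p : ℕ × ℕ ↦ q ^ ((p.1 + 1) * (p.2 + 1)) / ((p.2 : ℂ) + 1) ^ 3 := by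
  have h3 : Summable fun n : ℕ ↦ 1 / ((n : ℝ) + 1) ^ 3 := by
    have := (summable_nat_add_iff 1).mpr (Real.summable_one_div_nat_pow.mpr (by norm_num : 1 < 3))
    simpa using this
  refine Summable.of_norm_bounded ((summable_geometric_of_lt_one (norm_nonneg q) hq).mul_of_nonneg
    h3 (fun _ ↦ by positivity) (fun _ ↦ by positivity)) fun p ↦ ?_
  have hn : ‖(p.2 : ℂ) + 1‖ = (p.2 : ℝ) + 1 := by
    rw [← Nat.cast_add_one, Complex.norm_natCast]; push_cast; rfl
  rw [norm_div, norm_pow, norm_pow, hn, div_eq_mul_one_div]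
  gcongr ?_ * _
  exact pow_le_pow_of_le_one (norm_nonneg q) hq.le (by nlinarith)

lemma tsum_pow_succ_mul {x : ℂ} (hx : ‖x‖ < 1) : ∑' m : ℕ, x ^ (m + 1) = x / (1 - x) := by
  simp_rw [pow_succ']
  rw [tsum_mul_left, tsum_geometric_of_norm_lt_one hx, div_eq_mul_inv]

lemma tsum_pow_mul_div_cube {q : ℂ} (hq : ‖q‖ < 1) (n : ℕ) :
    ∑' m : ℕ, q ^ ((m + 1) * (n + 1)) / ((n : ℂ) + 1) ^ 3 = lambertTerm q (n + 1) := by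
  have h : ‖q ^ (n + 1)‖ < 1 := by
    rw [norm_pow]; exact pow_lt_one₀ (norm_nonneg q) hq (by simp)
  simp_rw [tsum_div_const, mul_comm _ (n + 1), pow_mul]
  rw [tsum_pow_succ_mul h, lambertTerm]
  push_cast; rfl

lemma summable_lambertTerm {q : ℂ} (hq : ‖q‖ < 1) : Summable (lambertTerm q) := by
  rw [← summable_nat_add_iff 1]
  refine (summable_pow_mul_div_cube hq).prod_symm.prod.congr fun n ↦ ?_
  rw [← tsum_pow_mul_div_cube hq n]
  rfl

lemma lambertTerm_zero (q : ℂ) : lambertTerm q 0 = 0 := by simp [lambertTerm]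

lemma F₃_eq_tsum_lambertTerm {τ : ℂ} (hτ : 0 < τ.im) :
    F₃ τ = ∑' n : ℕ, lambertTerm (Complex.exp (2 * π * Complex.I * τ)) n := by
  have hq := norm_cexp_two_pi_I_mul_lt_one hτ
  set q := Complex.exp (2 * π * Complex.I * τ) with hqdef
  have h (m n : ℕ) : Complex.exp (2 * π * Complex.I * ((m : ℂ) + 1) * ((n : ℂ) + 1) * τ) =
      q ^ ((m + 1) * (n + 1)) := by
    rw [hqdef, ← Complex.exp_nat_mul]
    congr 1
    push_cast; ring
  simp_rw [F₃, h]
  rw [(summable_lambertTerm hq).tsum_eq_zero_add, lambertTerm_zero, zero_add,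
    ← Summable.tsum_comm (f := fun m n : ℕ ↦ q ^ ((m + 1) * (n + 1)) / ((n : ℂ) + 1) ^ 3)
      (summable_pow_mul_div_cube hq)]
  exact tsum_congr (tsum_pow_mul_div_cube hq)

/-- `F₃` is an eigenfunction of the Hecke operator at the prime `2`. -/
lemma F₃_hecke_two {τ : ℂ} (hτ : 0 < τ.im) :
    F₃ (τ / 2) + F₃ ((τ + 1) / 2) = 9 / 4 * F₃ τ - 1 / 4 * F₃ (2 * τ) := by
  set p := Complex.exp (2 * π * Complex.I * (τ / 2)) with hp
  have h1 : 0 < (τ / 2).im := by simpa using hτ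
  have hp1 : ‖p‖ < 1 := norm_cexp_two_pi_I_mul_lt_one h1
  have hp' : Complex.exp (2 * π * Complex.I * ((τ + 1) / 2)) = -p := by
    rw [show 2 * π * Complex.I * ((τ + 1) / 2) =
      2 * π * Complex.I * (τ / 2) + π * Complex.I by ring, Complex.exp_add, Complex.exp_pi_mul_I]
    ring
  have hp2 : Complex.exp (2 * π * Complex.I * τ) = p ^ 2 := by
    rw [hp, ← Complex.exp_nat_mul]; congr 1; push_cast; ring
  have hp4 : Complex.exp (2 * π * Complex.I * (2 * τ)) = p ^ 4 := by
    rw [hp, ← Complex.exp_nat_mul]; congr 1; push_cast; ring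
  have hnorm (k : ℕ) (hk : k ≠ 0) : ‖p ^ k‖ < 1 := by
    rw [norm_pow]; exact pow_lt_one₀ (norm_nonneg p) hp1 hk
  rw [F₃_eq_tsum_lambertTerm h1, F₃_eq_tsum_lambertTerm (τ := (τ + 1) / 2) (by simpa using hτ),
    F₃_eq_tsum_lambertTerm hτ, F₃_eq_tsum_lambertTerm (τ := 2 * τ) (by simpa using hτ),
    hp', hp2, hp4, ← hp]
  have s1 := summable_lambertTerm hp1
  have s2 := summable_lambertTerm (q := -p) (by rwa [norm_neg])
  have s3 := summable_lambertTerm (hnorm 2 (by norm_num))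
  have s4 := summable_lambertTerm (hnorm 4 (by norm_num))
  have heven (q : ℂ) (k : ℕ) : lambertTerm q (2 * k) = 1 / 8 * lambertTerm (q ^ 2) k := by
    rw [lambertTerm, lambertTerm, ← pow_mul]
    push_cast
    rw [mul_pow, ← div_div]
    ring
  have hodd (k : ℕ) : lambertTerm p (2 * k + 1) + lambertTerm (-p) (2 * k + 1) =
      2 * lambertTerm (p ^ 2) (2 * k + 1) := by
    have hne (x : ℂ) (hx : ‖x‖ < 1) : 1 - x ≠ 0 := by
      intro h
      rw [← sub_eq_zero.mp h] at hx
      simp at hx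
    have ha := hne (p ^ (2 * k + 1)) (hnorm _ (by simp))
    have hb := hne (-p ^ (2 * k + 1)) (by rw [norm_neg]; exact hnorm _ (by simp))
    have hc := hne ((p ^ (2 * k + 1)) ^ 2) (by rw [← pow_mul]; exact hnorm _ (by simp))
    have hodd : (-p) ^ (2 * k + 1) = -p ^ (2 * k + 1) := Odd.neg_pow ⟨k, rfl⟩ p
    rw [lambertTerm, lambertTerm, lambertTerm, hodd, ← add_div, ← mul_div_assoc, ← pow_mul,
      mul_comm 2 (2 * k + 1), pow_mul p (2 * k + 1) 2]
    congr 1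
    field_simp
    ring
  have e2 : Function.Injective fun k : ℕ ↦ 2 * k := fun a b h ↦ by simpa using h
  have o2 : Function.Injective fun k : ℕ ↦ 2 * k + 1 := fun a b h ↦ by simpa using h
  rw [← tsum_even_add_odd (s1.comp_injective e2) (s1.comp_injective o2),
    ← tsum_even_add_odd (s2.comp_injective e2) (s2.comp_injective o2)]
  have h3 := tsum_even_add_odd (s3.comp_injective e2) (s3.comp_injective o2)
  have h4 := (s1.comp_injective o2).tsum_add (s2.comp_injective o2)
  simp only [Function.comp_def, hodd, heven, tsum_mul_left, even_two.neg_pow, ← pow_mul] at h3 h4 ⊢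
  norm_num at h3 h4 ⊢
  linear_combination -h4 + 2 * h3

lemma lambert_eq_partial_fractions {w : ℂ} (hw : 0 < w.im) :
    Complex.exp (2 * π * Complex.I * w) / (1 - Complex.exp (2 * π * Complex.I * w)) =
      -1 / 2 + Complex.I / (2 * π) *
        (1 / w + 2 * w * ∑' m : ℕ, 1 / (w ^ 2 - ((m : ℂ) + 1) ^ 2)) := by
  have hwZ : w ∈ Complex.integerComplement := by
    rintro ⟨k, rfl⟩
    simp at hw
  have hcot := cot_series_rep' hwZ
  have hne : 1 - Complex.exp (2 * π * Complex.I * w) ≠ 0 := by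
    intro h
    have := norm_cexp_two_pi_I_mul_lt_one hw
    rw [← sub_eq_zero.mp h] at this
    simp at this
  have hterm (m : ℕ) : 1 / (w - ((m : ℂ) + 1)) + 1 / (w + ((m : ℂ) + 1)) =
      2 * w * (1 / (w ^ 2 - ((m : ℂ) + 1) ^ 2)) := by
    have h := cotTerm_identity hwZ m
    rw [cotTerm] at h
    rw [h, sq_sub_sq]
  simp_rw [hterm] at hcot
  rw [tsum_mul_left, Complex.cot_pi_eq_exp_ratio] at hcot
  rw [← hcot]
  have hpi : (π : ℂ) ≠ 0 := by exact_mod_cast Real.pi_ne_zero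
  have hI := Complex.I_ne_zero
  generalize Complex.exp (2 * π * Complex.I * w) = q at *
  field_simp
  ring

lemma mul_im_le_norm_mul_sub (τ : ℂ) (x y : ℝ) : y * τ.im ≤ ‖x * τ - y‖ * ‖τ‖ := by
  calc y * τ.im ≤ |((x * τ - y) * (starRingEnd ℂ) τ).im| := by
        refine le_trans (le_of_eq ?_) (le_abs_self _)
        simp; ring
    _ ≤ ‖(x * τ - y) * (starRingEnd ℂ) τ‖ := Complex.abs_im_le_norm _
    _ = _ := by rw [norm_mul, RCLike.norm_conj]

/-- The general term of the double series which controls the behaviour of `F₃` under inversion. -/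
noncomputable def crossTerm (τ : ℂ) (p : ℕ × ℕ) : ℂ :=
  1 / (((p.1 : ℂ) + 1) ^ 2 * ((((p.1 : ℂ) + 1) * τ) ^ 2 - ((p.2 : ℂ) + 1) ^ 2))

lemma crossTerm_denom_bound {τ : ℂ} (hτ : 0 < τ.im) (m n : ℕ) :
    ((m : ℝ) + 1) ^ 2 * (τ.im / ‖τ‖) ^ 2 ≤ ‖(((n : ℂ) + 1) * τ) ^ 2 - ((m : ℂ) + 1) ^ 2‖ := by
  have h0 : 0 < ‖τ‖ := norm_pos_iff.mpr (by rintro rfl; simp at hτ)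
  have ha := mul_im_le_norm_mul_sub τ (n + 1) (m + 1)
  have hb := mul_im_le_norm_mul_sub τ (-(n + 1)) (m + 1)
  push_cast at ha hb
  rw [← div_le_iff₀ h0] at ha hb
  have hf : (((n : ℂ) + 1) * τ) ^ 2 - ((m : ℂ) + 1) ^ 2 =
      -((((n : ℂ) + 1) * τ - (m + 1)) * (-((n : ℂ) + 1) * τ - (m + 1))) := by ring
  rw [hf, norm_neg, norm_mul]
  calc _ = (((m : ℝ) + 1) * τ.im / ‖τ‖) * (((m : ℝ) + 1) * τ.im / ‖τ‖) := by ring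
    _ ≤ _ := by gcongr

lemma crossTerm_denom_ne_zero {τ : ℂ} (hτ : 0 < τ.im) (m n : ℕ) :
    (((n : ℂ) + 1) * τ) ^ 2 - ((m : ℂ) + 1) ^ 2 ≠ 0 := by
  have h0 : 0 < ‖τ‖ := norm_pos_iff.mpr (by rintro rfl; simp at hτ)
  exact norm_pos_iff.mp (lt_of_lt_of_le (by positivity) (crossTerm_denom_bound hτ m n))

lemma summable_one_div_succ_sq : Summable fun n : ℕ ↦ 1 / ((n : ℝ) + 1) ^ 2 := by
  have := (summable_nat_add_iff 1).mpr (Real.summable_one_div_nat_pow.mpr (by norm_num : 1 < 2))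
  simpa using this

lemma summable_crossTerm {τ : ℂ} (hτ : 0 < τ.im) : Summable (crossTerm τ) := by
  have h0 : 0 < ‖τ‖ := norm_pos_iff.mpr (by rintro rfl; simp at hτ)
  refine Summable.of_norm_bounded (((summable_one_div_succ_sq).mul_of_nonneg
    summable_one_div_succ_sq (fun _ ↦ by positivity) (fun _ ↦ by positivity)).mul_left
    (1 / (τ.im / ‖τ‖) ^ 2)) fun p ↦ ?_
  have hn : ‖(p.1 : ℂ) + 1‖ = (p.1 : ℝ) + 1 := by
    rw [← Nat.cast_add_one, Complex.norm_natCast]; push_cast; rfl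
  rw [crossTerm, norm_div, norm_mul, norm_pow, hn, norm_one, one_div_mul_one_div_rev,
    one_div_mul_one_div_rev]
  refine one_div_le_one_div_of_le (by positivity) ?_
  have := crossTerm_denom_bound hτ p.2 p.1
  calc _ = ((p.1 : ℝ) + 1) ^ 2 * (((p.2 : ℝ) + 1) ^ 2 * (τ.im / ‖τ‖) ^ 2) := by ring
    _ ≤ _ := by gcongr

lemma riemannZeta_natCast_eq_tsum_succ {k : ℕ} (hk : 1 < k) :
    riemannZeta k = ∑' n : ℕ, 1 / ((n : ℂ) + 1) ^ k := by
  have := zeta_eq_tsum_one_div_nat_add_one_cpow (s := k) (by simpa using hk)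
  simpa using this

lemma summable_one_div_succ_pow {k : ℕ} (hk : 1 < k) :
    Summable fun n : ℕ ↦ 1 / ((n : ℂ) + 1) ^ k := by
  have := (summable_nat_add_iff 1).mpr (Real.summable_one_div_nat_pow.mpr hk)
  refine (Complex.ofRealCLM.summable this).congr fun n ↦ ?_
  simp

lemma im_neg_one_div_pos {τ : ℂ} (hτ : 0 < τ.im) : 0 < (-1 / τ).im := by
  have h0 : 0 < Complex.normSq τ := Complex.normSq_pos.mpr (by rintro rfl; simp at hτ)
  rw [neg_div, one_div, Complex.neg_im, Complex.inv_im, neg_div, neg_neg]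
  positivity

lemma tsum_crossTerm_add_inversion {τ : ℂ} (hτ : 0 < τ.im) :
    ∑' p, crossTerm τ p + ∑' p, crossTerm (-1 / τ) p = -riemannZeta 2 ^ 2 := by
  have h0 : τ ≠ 0 := by rintro rfl; simp at hτ
  have s1 := summable_crossTerm hτ
  have s2 := summable_crossTerm (im_neg_one_div_pos hτ)
  have s3 := summable_one_div_succ_pow one_lt_two
  rw [← (Equiv.prodComm ℕ ℕ).tsum_eq (crossTerm (-1 / τ)),
    ← s1.tsum_add (g := fun p ↦ crossTerm (-1 / τ) (Equiv.prodComm ℕ ℕ p))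
      ((Equiv.prodComm ℕ ℕ).summable_iff.mpr s2), sq, ← Nat.cast_two,
    riemannZeta_natCast_eq_tsum_succ one_lt_two,
    tsum_mul_tsum_of_summable_norm s3.norm s3.norm, ← tsum_neg]
  refine tsum_congr fun p ↦ ?_
  have hd := crossTerm_denom_ne_zero hτ p.2 p.1
  have hn := Nat.cast_add_one_ne_zero (R := ℂ) p.1
  have hm := Nat.cast_add_one_ne_zero (R := ℂ) p.2
  have hd' : (((p.2 : ℂ) + 1) * (-1 / τ)) ^ 2 - ((p.1 : ℂ) + 1) ^ 2 =
      -((((p.1 : ℂ) + 1) * τ) ^ 2 - ((p.2 : ℂ) + 1) ^ 2) / τ ^ 2 := by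
    field_simp
    ring
  simp only [crossTerm, Equiv.prodComm_apply, Prod.fst_swap, Prod.snd_swap]
  rw [hd']
  generalize hD : (((p.1 : ℂ) + 1) * τ) ^ 2 - ((p.2 : ℂ) + 1) ^ 2 = D at *
  field_simp
  rw [← hD]
  ring

lemma F₃_eq_tsum_crossTerm {τ : ℂ} (hτ : 0 < τ.im) :
    F₃ τ = -riemannZeta 3 / 2 + Complex.I / (2 * π) *
      (riemannZeta 4 / τ + 2 * τ * ∑' p, crossTerm τ p) := by
  have hq := norm_cexp_two_pi_I_mul_lt_one hτ
  have h0 : τ ≠ 0 := by rintro rfl; simp at hτ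
  have s3 := summable_one_div_succ_pow (k := 3) (by norm_num)
  have s4 := summable_one_div_succ_pow (k := 4) (by norm_num)
  have s := summable_crossTerm hτ
  have hterm (n : ℕ) : lambertTerm (Complex.exp (2 * π * Complex.I * τ)) (n + 1) =
      -1 / 2 * (1 / ((n : ℂ) + 1) ^ 3) + (Complex.I / (2 * π) / τ * (1 / ((n : ℂ) + 1) ^ 4) +
        Complex.I / (2 * π) * (2 * τ) * ∑' m, crossTerm τ (n, m)) := by
    have hn := Nat.cast_add_one_ne_zero (R := ℂ) n
    have him : 0 < (((n : ℂ) + 1) * τ).im := by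
      rw [← Nat.cast_add_one, ← Complex.ofReal_natCast, Complex.im_ofReal_mul]
      positivity
    have := lambert_eq_partial_fractions him
    have hpow : Complex.exp (2 * π * Complex.I * τ) ^ (n + 1) =
        Complex.exp (2 * π * Complex.I * (((n : ℂ) + 1) * τ)) := by
      rw [← Complex.exp_nat_mul]; congr 1; push_cast; ring
    have hsum : ∑' m, crossTerm τ (n, m) = 1 / ((n : ℂ) + 1) ^ 2 *
        ∑' m : ℕ, 1 / ((((n : ℂ) + 1) * τ) ^ 2 - ((m : ℂ) + 1) ^ 2) := by
      rw [← tsum_mul_left]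
      exact tsum_congr fun m ↦ by rw [crossTerm, one_div_mul_one_div]
    rw [lambertTerm, hpow, this, hsum]
    push_cast
    have hpi : (π : ℂ) ≠ 0 := by exact_mod_cast Real.pi_ne_zero
    field_simp
  rw [F₃_eq_tsum_lambertTerm hτ, (summable_lambertTerm hq).tsum_eq_zero_add, lambertTerm_zero,
    zero_add, tsum_congr hterm, (s3.mul_left _).tsum_add ((s4.mul_left _).add (s.prod.mul_left _)),
    (s4.mul_left _).tsum_add (s.prod.mul_left _), tsum_mul_left, tsum_mul_left, tsum_mul_left,
    ← riemannZeta_natCast_eq_tsum_succ (by norm_num), ← riemannZeta_natCast_eq_tsum_succ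
    (by norm_num), ← s.tsum_prod]
  push_cast
  ring

/-- The transformation of `F₃` under inversion (Ramanujan's formula for `ζ(3)`). -/
lemma F₃_inversion {τ : ℂ} (hτ : 0 < τ.im) :
    F₃ τ - τ ^ 2 * F₃ (-1 / τ) = (τ ^ 2 - 1) * riemannZeta 3 / 2 +
      Complex.I * π ^ 3 * (1 / τ - 5 * τ + τ ^ 3) / 180 := by
  have h0 : τ ≠ 0 := by rintro rfl; simp at hτ
  have hpi : (π : ℂ) ≠ 0 := by exact_mod_cast Real.pi_ne_zero
  have h := tsum_crossTerm_add_inversion hτ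
  rw [riemannZeta_two] at h
  rw [F₃_eq_tsum_crossTerm hτ, F₃_eq_tsum_crossTerm (im_neg_one_div_pos hτ),
    eq_sub_of_add_eq h, riemannZeta_four]
  field_simp
  ring

lemma F₃_add_one (τ : ℂ) : F₃ (τ + 1) = F₃ τ := by
  refine tsum_congr fun m ↦ tsum_congr fun n ↦ ?_
  congr 1
  rw [Complex.exp_eq_exp_iff_exists_int]
  refine ⟨(m + 1) * (n + 1), ?_⟩
  push_cast; ring

theorem F₃_value_c :
    8 * (3 * F₃ (Real.sqrt 3 * Complex.I / 6) - F₃ (Real.sqrt 3 * Complex.I / 2)) -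
        9 * (3 * F₃ (Real.sqrt 3 * Complex.I / 3) - F₃ (Real.sqrt 3 * Complex.I)) =
      ((7 * Real.sqrt 3 * Real.pi ^ 3 / 135 : ℝ) : ℂ) + riemannZeta 3 := by
  set r : ℂ := (Real.sqrt 3 : ℂ) with hr
  have hr2 : r ^ 2 = 3 := by
    rw [hr, ← Complex.ofReal_pow, Real.sq_sqrt (by norm_num)]; norm_num
  have hI2 : Complex.I ^ 2 = -1 := Complex.I_sq
  have hs : 0 < (r * Complex.I).im := by simp [hr]
  have hsI : r * Complex.I * Complex.I = -r := by linear_combination r * hI2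
  have hs2 : (r * Complex.I) ^ 2 = -3 := by rw [mul_pow, hr2, hI2]; ring
  generalize r * Complex.I = s at *
  have i1 := F₃_inversion hs
  have i2 := F₃_inversion (τ := 2 * s) (by simpa using hs)
  have i3 := F₃_inversion (τ := (s + 1) / 2) (by simpa using hs)
  have hecke := F₃_hecke_two hs
  have hs0 : s ≠ 0 := by rintro h; norm_num [h] at hs2
  have hs1 : s + 1 ≠ 0 := by
    intro h
    have : s = -1 := by linear_combination h
    norm_num [this] at hs2
  have inv : 1 / s = -s / 3 := by field_simp; linear_combination hs2
  have e1 : -1 / s = s / 3 := by linear_combination -inv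
  have e2 : -1 / (2 * s) = s / 6 := by field_simp; linear_combination -2 * hs2
  have e3 : -1 / ((s + 1) / 2) = (s - 1) / 2 := by field_simp; linear_combination -hs2
  have e3' : 1 / ((s + 1) / 2) = (1 - s) / 2 := by linear_combination -e3
  have inv2 : 1 / (2 * s) = -s / 6 := by linear_combination -e2
  have per : F₃ ((s - 1) / 2) = F₃ ((s + 1) / 2) := by
    rw [← F₃_add_one]; congr 1; ring
  have sq : ((s + 1) / 2) ^ 2 = (s - 1) / 2 := by linear_combination hs2 / 4
  have cube : ((s + 1) / 2) ^ 3 = -1 := by linear_combination (s + 3) / 8 * hs2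
  rw [e1, inv] at i1
  rw [e2, inv2] at i2
  rw [e3, per, e3', sq, cube] at i3
  have h1 : F₃ s + 3 * F₃ (s / 3) = -2 * riemannZeta 3 + 25 / 540 * r * π ^ 3 := by
    linear_combination i1 + (F₃ (s / 3) + riemannZeta 3 / 2 + Complex.I * π ^ 3 * s / 180) * hs2 -
      25 / 540 * π ^ 3 * hsI
  have h2 : F₃ (2 * s) + 12 * F₃ (s / 6) = -13 / 2 * riemannZeta 3 + 205 / 1080 * r * π ^ 3 := by
    linear_combination i2 + (4 * F₃ (s / 6) + 2 * riemannZeta 3 +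
      8 * Complex.I * π ^ 3 * s / 180) * hs2 - 205 / 1080 * π ^ 3 * hsI
  have h3 : F₃ ((s + 1) / 2) = -riemannZeta 3 / 2 + r * π ^ 3 / 90 := by
    linear_combination (3 + s) / 6 * i3 + ((F₃ ((s + 1) / 2) + riemannZeta 3 / 2) / 12 -
      Complex.I * π ^ 3 / 360) * hs2 - π ^ 3 / 90 * hsI
  push_cast
  rw [← hr]
  linear_combination 2 * h2 - 8 * hecke - 9 * h1 + 8 * h3
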